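/- arXiv:1501.05788 — 7 statements merged into one kernel-verified Lean document; each statement's English description precedes it below -/
import Mathlib

section
/- Fix d ∈ A with P(D_obs = d, R = 0) > 0 and P(D_obs = d, R = 1) > 0, and assume that P(T = t, D_obs = d, R = 1) > 0 for every t ∈ B with P(T = t, D_obs = d) > 0. Then for every t ∈ B with P(T = t, D_obs = d) > 0, the conditional distribution of the missing part satisfies P(T = t | D_obs = d, R = 0) = P(T = t | D_obs = d, R = 1) · Q(t) / ( Σ_{t'} P(T = t' | D_obs = d, R = 1) · Q(t') ), where the sum ranges over all t' ∈ B with P(T = t', D_obs = d) > 0, and in particular this sum is finite and strictly positive. (Lemma 1, discrete form.) -/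
open MeasureTheory

/-- Probability of an event, as a real number. -/
noncomputable def pr {Ω : Type*} [MeasurableSpace Ω] (μ : Measure Ω) (E : Set Ω) : ℝ :=
  (μ E).toReal

/-- Conditional probability `P(E | F) = P(E ∩ F) / P(F)`. -/
noncomputable def cpr {Ω : Type*} [MeasurableSpace Ω] (μ : Measure Ω) (E F : Set Ω) : ℝ :=
  pr μ (E ∩ F) / pr μ F

theorem pr_mono {Ω : Type*} [MeasurableSpace Ω] (μ : Measure Ω) [IsFiniteMeasure μ]
    {E F : Set Ω} (h : E ⊆ F) : pr μ E ≤ pr μ F :=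
  ENNReal.toReal_mono (measure_ne_top μ F) (measure_mono h)

/-- The law of total probability over the fibres of a countably valued variable. -/
theorem hasSum_pr_fiber_inter {Ω B : Type*} [MeasurableSpace Ω]
    [Countable B] [MeasurableSpace B] [MeasurableSingletonClass B]
    (μ : Measure Ω) [IsFiniteMeasure μ] {T : Ω → B} (hT : Measurable T)
    {F : Set Ω} (hF : MeasurableSet F) :
    HasSum (fun t => pr μ ({ω | T ω = t} ∩ F)) (pr μ F) := by
  have hU : (⋃ t, {ω | T ω = t} ∩ F) = F := by
    ext ω
    simp
  have hsum : μ F = ∑' t, μ ({ω | T ω = t} ∩ F) := by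
    have hdisj : Pairwise (Function.onFun Disjoint fun t => {ω | T ω = t} ∩ F) :=
      fun s t hst => Set.disjoint_left.2 fun ω hs ht => hst (hs.1.symm.trans ht.1)
    have hmeas (t : B) : MeasurableSet ({ω | T ω = t} ∩ F) :=
      (hT (measurableSet_singleton t)).inter hF
    rw [← measure_iUnion hdisj hmeas, hU]
  have hne : ∑' t, μ ({ω | T ω = t} ∩ F) ≠ ⊤ := hsum ▸ measure_ne_top μ F
  unfold pr
  rw [hsum, ENNReal.tsum_toReal_eq fun t => measure_ne_top μ _]
  exact (ENNReal.summable_toReal hne).hasSum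

/-- Lemma 1 of the paper, discrete form: the conditional distribution of the partly
observed variable `T` given the observed data and non-response (`R = 0`) equals its
conditional distribution given response (`R = 1`), reweighted by the conditional odds
of missingness `Q` and renormalized. -/
theorem stmt0 {Ω A B : Type*} [MeasurableSpace Ω]
    [Countable A] [MeasurableSpace A] [MeasurableSingletonClass A]
    [Countable B] [MeasurableSpace B] [MeasurableSingletonClass B]
    (μ : Measure Ω) [IsProbabilityMeasure μ]
    (Dobs : Ω → A) (T : Ω → B) (R : Ω → Bool)
    (hD : Measurable Dobs) (hT : Measurable T) (hR : Measurable R)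
    (d : A)
    (h0 : 0 < pr μ {ω | Dobs ω = d ∧ R ω = false})
    (h1 : 0 < pr μ {ω | Dobs ω = d ∧ R ω = true})
    (hpos : ∀ t : B, 0 < pr μ {ω | T ω = t ∧ Dobs ω = d} →
      0 < pr μ {ω | T ω = t ∧ Dobs ω = d ∧ R ω = true})
    (Q : B → ℝ)
    (hQ : ∀ t : B, 0 < pr μ {ω | T ω = t ∧ Dobs ω = d ∧ R ω = true} →
      Q t = cpr μ {ω | R ω = false} {ω | T ω = t ∧ Dobs ω = d} /
            cpr μ {ω | R ω = true} {ω | T ω = t ∧ Dobs ω = d}) :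
    ∀ t : B, 0 < pr μ {ω | T ω = t ∧ Dobs ω = d} →
      Summable (fun t' : {t' : B // 0 < pr μ {ω | T ω = t' ∧ Dobs ω = d}} =>
        cpr μ {ω | T ω = (t' : B)} {ω | Dobs ω = d ∧ R ω = true} * Q (t' : B)) ∧
      0 < (∑' t' : {t' : B // 0 < pr μ {ω | T ω = t' ∧ Dobs ω = d}},
        cpr μ {ω | T ω = (t' : B)} {ω | Dobs ω = d ∧ R ω = true} * Q (t' : B)) ∧
      cpr μ {ω | T ω = t} {ω | Dobs ω = d ∧ R ω = false} =
        cpr μ {ω | T ω = t} {ω | Dobs ω = d ∧ R ω = true} * Q t /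
        (∑' t' : {t' : B // 0 < pr μ {ω | T ω = t' ∧ Dobs ω = d}},
          cpr μ {ω | T ω = (t' : B)} {ω | Dobs ω = d ∧ R ω = true} * Q (t' : B)) := by
  have hF0 : MeasurableSet {ω | Dobs ω = d ∧ R ω = false} :=
    (hD (measurableSet_singleton d)).inter (hR (measurableSet_singleton false))
  have hterm : ∀ t, 0 < pr μ {ω | T ω = t ∧ Dobs ω = d} →
      cpr μ {ω | T ω = t} {ω | Dobs ω = d ∧ R ω = true} * Q t =
        pr μ ({ω | T ω = t} ∩ {ω | Dobs ω = d ∧ R ω = false}) /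
          pr μ {ω | Dobs ω = d ∧ R ω = true} := by
    intro t ht
    have hb := hpos t ht
    have hinter (r : Bool) : {ω | R ω = r} ∩ {ω | T ω = t ∧ Dobs ω = d} =
        {ω | T ω = t ∧ Dobs ω = d ∧ R ω = r} := by
      ext ω
      simp only [Set.mem_inter_iff, Set.mem_ofPred_eq]
      tauto
    have hinter' (r : Bool) : {ω | T ω = t} ∩ {ω | Dobs ω = d ∧ R ω = r} =
        {ω | T ω = t ∧ Dobs ω = d ∧ R ω = r} := rfl
    rw [hQ t hb]
    simp only [cpr, hinter, hinter']
    field_simp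
  have hsum : HasSum (fun t' : {t' : B // 0 < pr μ {ω | T ω = t' ∧ Dobs ω = d}} =>
      cpr μ {ω | T ω = (t' : B)} {ω | Dobs ω = d ∧ R ω = true} * Q (t' : B))
      (pr μ {ω | Dobs ω = d ∧ R ω = false} / pr μ {ω | Dobs ω = d ∧ R ω = true}) := by
    have hsupp : Function.support
        (fun t => pr μ ({ω | T ω = t} ∩ {ω | Dobs ω = d ∧ R ω = false})) ⊆
        {t' : B | 0 < pr μ {ω | T ω = t' ∧ Dobs ω = d}} := fun t ht =>
      (lt_of_le_of_ne ENNReal.toReal_nonneg (Ne.symm ht)).trans_le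
        (pr_mono μ fun ω hω => ⟨hω.1, hω.2.1⟩)
    have h := (hasSum_subtype_iff_of_support_subset hsupp).2 (hasSum_pr_fiber_inter μ hT hF0)
    rw [funext fun t' : {t' : B // 0 < pr μ {ω | T ω = t' ∧ Dobs ω = d}} => hterm t' t'.2]
    exact h.div_const _
  intro t ht
  refine ⟨hsum.summable, ?_, ?_⟩
  · rw [hsum.tsum_eq]
    exact div_pos h0 h1
  · rw [hsum.tsum_eq, hterm t ht, cpr, div_div_div_cancel_right₀ h1.ne']
end

section
/- Let V be a G-measurable real random variable such that V and V·Q are integrable. Then E[V · 1_{Ω∖R}] = E[V · Q · 1_R]. (Inverse-odds weighting identity underlying Lemma 1.) -/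
open MeasureTheory

open scoped MeasureTheory

/-- Multiplying by the indicator of a measurable set preserves integrability. -/
theorem integrable_mul_indicator_one {Ω : Type*} {F : MeasurableSpace Ω} {μ : Measure Ω}
    {R : Set Ω} (hR : MeasurableSet R) {W : Ω → ℝ} (hW : Integrable W μ) :
    Integrable (fun ω => W ω * R.indicator (fun _ => (1 : ℝ)) ω) μ := by
  refine (hW.indicator hR).congr (.of_forall fun ω => ?_)
  by_cases h : ω ∈ R <;> simp [h]

/-- Under the integral against a `G`-measurable weight, the indicator of an event may be replaced
by any version of its conditional probability given `G`. -/
theorem integral_mul_indicator_one_eq {Ω : Type*} {G F : MeasurableSpace Ω} (hG : G ≤ F)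
    {μ : Measure Ω} [IsFiniteMeasure μ] {R : Set Ω} (hR : MeasurableSet[F] R) {p : Ω → ℝ}
    (hp : p =ᵐ[μ] μ[R.indicator (fun _ => (1 : ℝ)) | G])
    {W : Ω → ℝ} (hWm : Measurable[G] W) (hW : Integrable W μ) :
    ∫ ω, W ω * R.indicator (fun _ => (1 : ℝ)) ω ∂μ = ∫ ω, W ω * p ω ∂μ := by
  have hpull := condExp_mul_of_stronglyMeasurable_left (m := G) hWm.stronglyMeasurable
    (integrable_mul_indicator_one hR hW) ((integrable_const (1 : ℝ)).indicator hR)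
  refine (integral_condExp (f := W * R.indicator fun _ => (1 : ℝ)) hG).symm.trans
    (integral_congr_ae ?_)
  filter_upwards [hpull, hp] with ω h₁ h₂
  rw [h₁, Pi.mul_apply, h₂]

/-- Inverse-odds weighting identity underlying Lemma 1:
`E[V · 1_{Ω∖R}] = E[V · Q · 1_R]` for any `G`-measurable `V` with `V` and `V·Q`
integrable, where `Q = (1 − π)/π` and `π` is a version of `E[1_R | G]`. -/
theorem stmt3 {Ω : Type*} {F : MeasurableSpace Ω} (μ : Measure Ω) [IsProbabilityMeasure μ]
    (R : Set Ω) (hR : MeasurableSet R)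
    (G : MeasurableSpace Ω) (hG : G ≤ F)
    (π : Ω → ℝ) (hπ_meas : Measurable[G] π)
    (hπ_ver : π =ᵐ[μ] μ[R.indicator (fun _ => (1 : ℝ)) | G])
    (hπ_pos : ∀ᵐ ω ∂μ, 0 < π ω) (hπ_lt1 : ∀ᵐ ω ∂μ, π ω < 1)
    (Q : Ω → ℝ) (hQ : ∀ ω, Q ω = (1 - π ω) / π ω)
    (V : Ω → ℝ) (hV_meas : Measurable[G] V)
    (hV : Integrable V μ) (hVQ : Integrable (fun ω => V ω * Q ω) μ) :
    ∫ ω, V ω * Rᶜ.indicator (fun _ => (1 : ℝ)) ω ∂μ =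
      ∫ ω, V ω * Q ω * R.indicator (fun _ => (1 : ℝ)) ω ∂μ := by
  have hQ_meas : Measurable[G] Q := by
    rw [funext hQ]
    exact (measurable_const.sub hπ_meas).div hπ_meas
  have hVπ := integral_mul_indicator_one_eq hG hR hπ_ver hV_meas hV
  have hVQπ := integral_mul_indicator_one_eq hG hR hπ_ver (hV_meas.mul hQ_meas) hVQ
  have hcompl : ∀ ω, V ω * Rᶜ.indicator (fun _ => (1 : ℝ)) ω =
      V ω - V ω * R.indicator (fun _ => (1 : ℝ)) ω := by
    intro ω
    by_cases h : ω ∈ R <;> simp [h]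
  have hprod : (fun ω => V ω * Q ω * π ω) =ᵐ[μ] fun ω => V ω - V ω * π ω := by
    filter_upwards [hπ_pos] with ω h
    rw [hQ]
    field_simp
  have hVπ_int : Integrable (fun ω => V ω * π ω) μ := by
    have hpull := condExp_mul_of_stronglyMeasurable_left (m := G) hV_meas.stronglyMeasurable
      (integrable_mul_indicator_one hR hV) ((integrable_const (1 : ℝ)).indicator hR)
    refine (integrable_condExp.congr hpull).congr ?_
    filter_upwards [hπ_ver] with ω h
    rw [Pi.mul_apply, h]
  simp_rw [hcompl]
  rw [integral_sub hV (integrable_mul_indicator_one hR hV), hVπ]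
  exact (hVQπ.trans ((integral_congr_ae hprod).trans (integral_sub hV hVπ_int))).symm
end

section
/- Let V be a G-measurable real random variable such that V and V·Q are integrable, and let H ⊆ G be a sub-σ-algebra (generated by the observed data). Then E[V · 1_{Ω∖R} | H] = E[V · Q · 1_R | H] almost surely. -/
open MeasureTheory

open scoped MeasureTheory

/-- Weighted indicators of an event pull out of the conditional expectation. -/
theorem condExp_mul_indicator_one {Ω : Type*} {m m₀ : MeasurableSpace Ω} {μ : Measure[m₀] Ω}
    [IsFiniteMeasure μ] {S : Set Ω} (hS : MeasurableSet[m₀] S) {W : Ω → ℝ}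
    (hW : StronglyMeasurable[m] W) (hWi : Integrable W μ) :
    μ[(fun ω => W ω * S.indicator (fun _ => (1 : ℝ)) ω) | m] =ᵐ[μ]
      fun ω => W ω * (μ[S.indicator (fun _ => (1 : ℝ)) | m]) ω := by
  have hWS : Integrable (W * S.indicator (fun _ => (1 : ℝ))) μ := by
    have h : W * S.indicator (fun _ => (1 : ℝ)) = S.indicator W := by
      ext ω
      by_cases hω : ω ∈ S <;> simp [hω]
    rw [h]
    exact hWi.indicator hS
  exact condExp_mul_of_stronglyMeasurable_left hW hWS ((integrable_const 1).indicator hS)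

/-- The conditional probabilities of an event and of its complement sum to one. -/
theorem condExp_indicator_compl_one {Ω : Type*} {m m₀ : MeasurableSpace Ω} {μ : Measure[m₀] Ω}
    [IsFiniteMeasure μ] (hm : m ≤ m₀) {S : Set Ω} (hS : MeasurableSet[m₀] S) :
    μ[Sᶜ.indicator (fun _ => (1 : ℝ)) | m] =ᵐ[μ]
      fun ω => 1 - (μ[S.indicator (fun _ => (1 : ℝ)) | m]) ω := by
  have h : Sᶜ.indicator (fun _ => (1 : ℝ)) = (fun _ => (1 : ℝ)) - S.indicator fun _ => 1 :=
    Set.indicator_compl S _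
  rw [h]
  filter_upwards [condExp_sub (integrable_const (1 : ℝ))
    ((integrable_const (1 : ℝ)).indicator hS) m] with ω hω
  rw [hω, Pi.sub_apply, condExp_const hm]

/-- Conditional version of the inverse-odds weighting identity:
`E[V · 1_{Ω∖R} | H] = E[V · Q · 1_R | H]` almost surely, for any sub-σ-algebra
`H ⊆ G` generated by the observed data. -/
theorem stmt4 {Ω : Type*} {F : MeasurableSpace Ω} (μ : Measure Ω) [IsProbabilityMeasure μ]
    (R : Set Ω) (hR : MeasurableSet R)
    (G : MeasurableSpace Ω) (hG : G ≤ F)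
    (π : Ω → ℝ) (hπ_meas : Measurable[G] π)
    (hπ_ver : π =ᵐ[μ] μ[R.indicator (fun _ => (1 : ℝ)) | G])
    (hπ_pos : ∀ᵐ ω ∂μ, 0 < π ω) (hπ_lt1 : ∀ᵐ ω ∂μ, π ω < 1)
    (Q : Ω → ℝ) (hQ : ∀ ω, Q ω = (1 - π ω) / π ω)
    (V : Ω → ℝ) (hV_meas : Measurable[G] V)
    (hV : Integrable V μ) (hVQ : Integrable (fun ω => V ω * Q ω) μ)
    (H : MeasurableSpace Ω) (hH : H ≤ G) :
    μ[(fun ω => V ω * Rᶜ.indicator (fun _ => (1 : ℝ)) ω) | H] =ᵐ[μ]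
      μ[(fun ω => V ω * Q ω * R.indicator (fun _ => (1 : ℝ)) ω) | H] := by
  have hQ_meas : Measurable[G] Q := by
    rw [funext hQ]
    exact (measurable_const.sub hπ_meas).div hπ_meas
  have hodds : μ[(fun ω => V ω * Rᶜ.indicator (fun _ => (1 : ℝ)) ω) | G] =ᵐ[μ]
      μ[(fun ω => V ω * Q ω * R.indicator (fun _ => (1 : ℝ)) ω) | G] := by
    filter_upwards [condExp_mul_indicator_one hR.compl hV_meas.stronglyMeasurable hV,
      condExp_mul_indicator_one hR (hV_meas.mul hQ_meas).stronglyMeasurable hVQ,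
      condExp_indicator_compl_one hG hR, hπ_ver, hπ_pos] with ω h₁ h₂ h₃ h₄ h₅
    simp only [Pi.mul_apply] at h₂
    rw [h₁, h₂, h₃, ← h₄, hQ]
    field_simp
  exact (condExp_condExp_of_le hH hG).symm.trans
    ((condExp_congr_ae hodds).trans (condExp_condExp_of_le hH hG))
end

section
/- Let V be a G-measurable real random variable such that V and V·Q are integrable, and let H ⊆ G be a sub-σ-algebra (generated by the observed data). Then almost everywhere on the event {E[1_{Ω∖R} | H] > 0} one has E[V · 1_{Ω∖R} | H] / E[1_{Ω∖R} | H] = E[V · Q · 1_R | H] / E[Q · 1_R | H]; that is, the conditional distribution of the data given the observed information and non-response equals the conditional distribution given the observed information and response, reweighted by the conditional odds of missingness Q and renormalized. (Lemma 1, measure-theoretic form.) -/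
open MeasureTheory

open scoped MeasureTheory

/-- The defining property of the conditional probability `E[1_R | m]`, extended from `m`-measurable
sets to nonnegative `m`-measurable functions. -/
lemma setLIntegral_eq_lintegral_mul_condExp_indicator {Ω : Type*} {m m₀ : MeasurableSpace Ω}
    {μ : Measure Ω} [IsFiniteMeasure μ] (hm : m ≤ m₀) {R : Set Ω} (hR : MeasurableSet[m₀] R)
    {f : Ω → ENNReal} (hf : Measurable[m] f) :
    ∫⁻ ω in R, f ω ∂μ =
      ∫⁻ ω, ENNReal.ofReal ((μ[R.indicator (fun _ => (1 : ℝ)) | m]) ω) * f ω ∂μ := by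
  set p : Ω → ℝ := μ[R.indicator (fun _ => (1 : ℝ)) | m] with hp
  have hR_int : Integrable (R.indicator (fun _ => (1 : ℝ))) μ :=
    (integrable_const 1).indicator hR
  have hp_meas : Measurable[m₀] fun ω => ENNReal.ofReal (p ω) :=
    ((stronglyMeasurable_condExp.mono hm).measurable).ennreal_ofReal
  have hp_nonneg : 0 ≤ᵐ[μ] p :=
    condExp_nonneg (Filter.Eventually.of_forall fun ω =>
      Set.indicator_nonneg (fun _ _ => zero_le_one) ω)
  have htrim : (μ.restrict R).trim hm =
      (μ.withDensity fun ω => ENNReal.ofReal (p ω)).trim hm := by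
    refine @Measure.ext _ m _ _ fun s hs => ?_
    rw [trim_measurableSet_eq hm hs, trim_measurableSet_eq hm hs, withDensity_apply _ (hm s hs),
      Measure.restrict_apply (hm s hs),
      ← ofReal_integral_eq_lintegral_ofReal integrable_condExp.integrableOn
        (ae_restrict_of_ae hp_nonneg),
      setIntegral_condExp hm hR_int hs, integral_indicator_const (1 : ℝ) hR]
    simp [Measure.real, Measure.restrict_apply hR, Set.inter_comm]
  rw [← lintegral_trim hm hf, htrim, lintegral_trim hm hf,
    lintegral_withDensity_eq_lintegral_mul _ hp_meas (hf.mono hm le_rfl)]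
  rfl

/-- If `f` is `m`-measurable and `f * E[1_R | m]` is integrable, then so is `f * 1_R`. -/
lemma integrable_mul_indicator_of_mul_condExp {Ω : Type*} {m m₀ : MeasurableSpace Ω}
    {μ : Measure Ω} [IsFiniteMeasure μ] (hm : m ≤ m₀) {R : Set Ω} (hR : MeasurableSet[m₀] R)
    {f : Ω → ℝ} (hf : Measurable[m] f)
    (hfp : Integrable (f * μ[R.indicator (fun _ => (1 : ℝ)) | m]) μ) :
    Integrable (f * R.indicator (fun _ => (1 : ℝ))) μ := by
  have heq : f * R.indicator (fun _ => (1 : ℝ)) = R.indicator f := by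
    ext ω; by_cases h : ω ∈ R <;> simp [h]
  rw [heq, integrable_indicator_iff hR]
  refine ⟨(hf.mono hm le_rfl).aestronglyMeasurable, ?_⟩
  have hp_nonneg : 0 ≤ᵐ[μ] μ[R.indicator (fun _ => (1 : ℝ)) | m] :=
    condExp_nonneg (Filter.Eventually.of_forall fun ω =>
      Set.indicator_nonneg (fun _ _ => zero_le_one) ω)
  rw [HasFiniteIntegral,
    setLIntegral_eq_lintegral_mul_condExp_indicator (f := fun ω => ‖f ω‖ₑ) hm hR
      (measurable_enorm.comp hf)]
  refine lt_of_le_of_lt (lintegral_mono_ae ?_) hfp.2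
  filter_upwards [hp_nonneg] with ω hω
  rw [Pi.mul_apply, enorm_mul, mul_comm, Real.enorm_of_nonneg hω]

/-- Lemma 1, measure-theoretic form: almost everywhere on the event
`{E[1_{Ω∖R} | H] > 0}`, the conditional distribution of the data given the observed
information and non-response equals the conditional distribution given the observed
information and response, reweighted by the conditional odds of missingness `Q`
and renormalized. -/
theorem stmt5 {Ω : Type*} {F : MeasurableSpace Ω} (μ : Measure Ω) [IsProbabilityMeasure μ]
    (R : Set Ω) (hR : MeasurableSet R)
    (G : MeasurableSpace Ω) (hG : G ≤ F)
    (π : Ω → ℝ) (hπ_meas : Measurable[G] π)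
    (hπ_ver : π =ᵐ[μ] μ[R.indicator (fun _ => (1 : ℝ)) | G])
    (hπ_pos : ∀ᵐ ω ∂μ, 0 < π ω) (hπ_lt1 : ∀ᵐ ω ∂μ, π ω < 1)
    (Q : Ω → ℝ) (hQ : ∀ ω, Q ω = (1 - π ω) / π ω)
    (V : Ω → ℝ) (hV_meas : Measurable[G] V)
    (hV : Integrable V μ) (hVQ : Integrable (fun ω => V ω * Q ω) μ)
    (H : MeasurableSpace Ω) (hH : H ≤ G) :
    ∀ᵐ ω ∂μ, 0 < (μ[Rᶜ.indicator (fun _ => (1 : ℝ)) | H]) ω →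
      (μ[(fun ω' => V ω' * Rᶜ.indicator (fun _ => (1 : ℝ)) ω') | H]) ω /
        (μ[Rᶜ.indicator (fun _ => (1 : ℝ)) | H]) ω =
      (μ[(fun ω' => V ω' * Q ω' * R.indicator (fun _ => (1 : ℝ)) ω') | H]) ω /
        (μ[(fun ω' => Q ω' * R.indicator (fun _ => (1 : ℝ)) ω') | H]) ω := by
  have hRc_eq : Rᶜ.indicator (fun _ => (1 : ℝ)) =
      (fun _ => (1 : ℝ)) - R.indicator (fun _ => (1 : ℝ)) := by
    ext ω; by_cases h : ω ∈ R <;> simp [h]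
  have hR_int : Integrable (R.indicator (fun _ => (1 : ℝ))) μ :=
    (integrable_const 1).indicator hR
  have hRc_int : Integrable (Rᶜ.indicator (fun _ => (1 : ℝ))) μ :=
    (integrable_const 1).indicator hR.compl
  have hQ_meas : Measurable[G] Q := by
    rw [show Q = fun ω => (1 - π ω) / π ω from funext hQ]
    exact (measurable_const.sub hπ_meas).div hπ_meas
  have hRc_condExp : μ[Rᶜ.indicator (fun _ => (1 : ℝ)) | G] =ᵐ[μ] fun ω => 1 - π ω := by
    rw [hRc_eq]
    filter_upwards [condExp_sub (integrable_const (1 : ℝ)) hR_int G, hπ_ver] with ω h₁ h₂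
    rw [h₁, Pi.sub_apply, condExp_const hG, h₂]
  have hQπ : Q * μ[R.indicator (fun _ => (1 : ℝ)) | G] =ᵐ[μ]
      μ[Rᶜ.indicator (fun _ => (1 : ℝ)) | G] := by
    filter_upwards [hRc_condExp, hπ_ver, hπ_pos] with ω h₁ h₂ h₃
    rw [Pi.mul_apply, h₁, ← h₂, hQ, div_mul_cancel₀ _ h₃.ne']
  have hQR_int : Integrable (Q * R.indicator (fun _ => (1 : ℝ))) μ :=
    integrable_mul_indicator_of_mul_condExp hG hR hQ_meas (integrable_condExp.congr hQπ.symm)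
  have hVRc_int : Integrable (V * Rᶜ.indicator (fun _ => (1 : ℝ))) μ := by
    refine (hV.indicator hR.compl).congr (.of_forall fun ω => ?_)
    by_cases h : ω ∈ R <;> simp [h]
  have hVQR_int : Integrable ((V * Q) * R.indicator (fun _ => (1 : ℝ))) μ := by
    refine (hVQ.indicator hR).congr (.of_forall fun ω => ?_)
    by_cases h : ω ∈ R <;> simp [h]
  have hden : μ[Q * R.indicator (fun _ => (1 : ℝ)) | G] =ᵐ[μ]
      μ[Rᶜ.indicator (fun _ => (1 : ℝ)) | G] :=
    (condExp_mul_of_stronglyMeasurable_left hQ_meas.stronglyMeasurable hQR_int hR_int).trans hQπ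
  have hnum : μ[(V * Q) * R.indicator (fun _ => (1 : ℝ)) | G] =ᵐ[μ]
      μ[V * Rᶜ.indicator (fun _ => (1 : ℝ)) | G] := by
    filter_upwards [condExp_mul_of_stronglyMeasurable_left
        (hV_meas.mul hQ_meas).stronglyMeasurable hVQR_int hR_int,
      condExp_mul_of_stronglyMeasurable_left hV_meas.stronglyMeasurable hVRc_int hRc_int,
      hQπ] with ω h₁ h₂ h₃
    rw [h₁, h₂, Pi.mul_apply, Pi.mul_apply, Pi.mul_apply, ← h₃, Pi.mul_apply, mul_assoc]
  have tower {f g : Ω → ℝ} (h : μ[f | G] =ᵐ[μ] μ[g | G]) : μ[f | H] =ᵐ[μ] μ[g | H] :=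
    (condExp_condExp_of_le hH hG).symm.trans
      ((condExp_congr_ae h).trans (condExp_condExp_of_le hH hG))
  filter_upwards [tower hden, tower hnum] with ω h₁ h₂ _
  exact (congrArg₂ (· / ·) h₂ h₁).symm
end

section
/- Fix y1 ∈ A with P(Y1 = y1, R = 0) > 0 and P(Y1 = y1, R = 1) > 0. Then for every y ∈ B with P(Y1 = y1, Y2 = y) > 0, the term h(y1) cancels and P(Y2 = y | Y1 = y1, R = 0) = P(Y2 = y | Y1 = y1, R = 1) · exp(−η·y) / ( Σ_{y'} P(Y2 = y' | Y1 = y1, R = 1) · exp(−η·y') ), where the sum ranges over y' ∈ B with P(Y1 = y1, Y2 = y') > 0 and is finite and strictly positive. -/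
open MeasureTheory

/-- `expit(t) = e^t / (1 + e^t)`. -/
noncomputable def expit (t : ℝ) : ℝ := Real.exp t / (1 + Real.exp t)

/-- The probabilities of the fibres of a countably valued random variable inside an event `E`,
indexed by any set carrying all the fibres of positive probability, sum to the probability
of `E`. -/
lemma hasSum_pr_fiber {Ω β : Type*} [MeasurableSpace Ω] [MeasurableSpace β]
    [MeasurableSingletonClass β] {μ : Measure Ω} [IsFiniteMeasure μ] {B S : Set β}
    (hB : B.Countable) {Y : Ω → β} (hY : Measurable Y) (hYB : ∀ ω, Y ω ∈ B)
    {E : Set Ω} (hE : MeasurableSet E) (hS : ∀ y, pr μ ({ω | Y ω = y} ∩ E) ≠ 0 → y ∈ S) :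
    HasSum (fun y : S => pr μ ({ω | Y ω = (y : β)} ∩ E)) (pr μ E) := by
  have := hB.to_subtype
  have hsupp : Function.support (fun y => pr μ ({ω | Y ω = y} ∩ E)) ⊆ B := by
    intro y hy
    by_contra hyB
    have hempty : {ω | Y ω = y} = ∅ :=
      Set.eq_empty_of_forall_notMem fun ω hω => hyB (hω ▸ hYB ω)
    simp [pr, hempty] at hy
  refine (hasSum_subtype_iff_of_support_subset (s := S) hS).2
    ((hasSum_subtype_iff_of_support_subset hsupp).1 ?_)
  have hunion : E = ⋃ y : B, {ω | Y ω = (y : β)} ∩ E := by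
    ext ω
    simp [hYB ω]
  have hmeas : μ E = ∑' y : B, μ ({ω | Y ω = (y : β)} ∩ E) := by
    conv_lhs => rw [hunion]
    refine measure_iUnion (fun y z hyz => ?_)
      fun y => (hY (measurableSet_singleton (y : β))).inter hE
    refine Set.disjoint_left.2 fun ω hy hz => hyz (Subtype.ext ?_)
    exact hy.1.symm.trans hz.1
  have hfin : ∑' y : B, μ ({ω | Y ω = (y : β)} ∩ E) ≠ ⊤ := hmeas ▸ measure_ne_top μ E
  have hsum := ENNReal.hasSum_toReal hfin
  rwa [← ENNReal.tsum_toReal_eq fun y => measure_ne_top μ _, ← hmeas] at hsum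

/-- If a part of mass `a` of a cell of mass `a + b` has relative mass `expit t`, then tilting
`a` by `exp (-t)` gives the mass `b` of the remainder. -/
lemma mul_exp_neg_eq_of_div_eq_expit {a b t : ℝ} (hab : a + b ≠ 0)
    (h : a / (a + b) = expit t) : a * Real.exp (-t) = b := by
  have ht := Real.exp_pos t
  rw [expit, div_eq_div_iff hab (by positivity)] at h
  rw [Real.exp_neg, ← div_eq_mul_inv, div_eq_iff ht.ne']
  linarith

/-- Under the logistic selection model `P(R = 1 | Y1, Y2) = expit(h(Y1) + η·Y2)`,
the nonparametric part `h(y1)` cancels and the conditional density of the missing part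
of `Y2` is the observed-data conditional density exponentially tilted by `exp(−η·y)`. -/
theorem stmt6 {Ω A : Type*} [MeasurableSpace Ω]
    [Countable A] [MeasurableSpace A] [MeasurableSingletonClass A]
    (μ : Measure Ω) [IsProbabilityMeasure μ]
    (B : Set ℝ) (hB : B.Countable)
    (Y1 : Ω → A) (Y2 : Ω → ℝ) (R : Ω → Bool)
    (hY1 : Measurable Y1) (hY2 : Measurable Y2) (hR : Measurable R)
    (hY2B : ∀ ω, Y2 ω ∈ B)
    (h : A → ℝ) (η : ℝ)
    (hsel : ∀ (y1 : A) (y2 : ℝ), y2 ∈ B →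
      0 < pr μ {ω | Y1 ω = y1 ∧ Y2 ω = y2} →
      cpr μ {ω | R ω = true} {ω | Y1 ω = y1 ∧ Y2 ω = y2} = expit (h y1 + η * y2))
    (y1 : A)
    (h0 : 0 < pr μ {ω | Y1 ω = y1 ∧ R ω = false})
    (h1 : 0 < pr μ {ω | Y1 ω = y1 ∧ R ω = true}) :
    ∀ y : ℝ, y ∈ B → 0 < pr μ {ω | Y1 ω = y1 ∧ Y2 ω = y} →
      Summable (fun y' : {y' : ℝ // y' ∈ B ∧ 0 < pr μ {ω | Y1 ω = y1 ∧ Y2 ω = y'}} =>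
        cpr μ {ω | Y2 ω = (y' : ℝ)} {ω | Y1 ω = y1 ∧ R ω = true} *
          Real.exp (-(η * (y' : ℝ)))) ∧
      0 < (∑' y' : {y' : ℝ // y' ∈ B ∧ 0 < pr μ {ω | Y1 ω = y1 ∧ Y2 ω = y'}},
        cpr μ {ω | Y2 ω = (y' : ℝ)} {ω | Y1 ω = y1 ∧ R ω = true} *
          Real.exp (-(η * (y' : ℝ)))) ∧
      cpr μ {ω | Y2 ω = y} {ω | Y1 ω = y1 ∧ R ω = false} =
        cpr μ {ω | Y2 ω = y} {ω | Y1 ω = y1 ∧ R ω = true} * Real.exp (-(η * y)) /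
        (∑' y' : {y' : ℝ // y' ∈ B ∧ 0 < pr μ {ω | Y1 ω = y1 ∧ Y2 ω = y'}},
          cpr μ {ω | Y2 ω = (y' : ℝ)} {ω | Y1 ω = y1 ∧ R ω = true} *
            Real.exp (-(η * (y' : ℝ)))) := by
  intro y hy hpos
  set S : Set ℝ := {y' | y' ∈ B ∧ 0 < pr μ {ω | Y1 ω = y1 ∧ Y2 ω = y'}}
  set E : Bool → Set Ω := fun r => {ω | Y1 ω = y1 ∧ R ω = r} with hE
  have hEmeas (r : Bool) : MeasurableSet (E r) :=
    (hY1 (measurableSet_singleton y1)).inter (hR (measurableSet_singleton r))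
  have htilt (z : ℝ) (hz : z ∈ S) :
      cpr μ {ω | Y2 ω = z} (E true) * Real.exp (-(η * z)) =
        pr μ ({ω | Y2 ω = z} ∩ E false) * (Real.exp (h y1) / pr μ (E true)) := by
    have hadd : pr μ ({ω | Y2 ω = z} ∩ E true) + pr μ ({ω | Y2 ω = z} ∩ E false) =
        pr μ {ω | Y1 ω = y1 ∧ Y2 ω = z} := by
      refine Eq.trans ?_ (measureReal_inter_add_sdiff (μ := μ) (s := {ω | Y1 ω = y1 ∧ Y2 ω = z})
        (hR (measurableSet_singleton true)))
      congr 1 <;> refine congrArg (pr μ) (Set.ext fun ω => ?_) <;> simp [hE] <;> tauto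
    have hcell := hsel y1 z hz.1 hz.2
    have hinter : {ω | R ω = true} ∩ {ω | Y1 ω = y1 ∧ Y2 ω = z} =
        {ω | Y2 ω = z} ∩ E true := by
      ext ω
      simp [hE]
      tauto
    rw [cpr, hinter, ← hadd] at hcell
    rw [← mul_exp_neg_eq_of_div_eq_expit (hadd ▸ hz.2.ne') hcell, cpr, neg_add, Real.exp_add,
      Real.exp_neg (h y1)]
    field_simp
  have hsum : HasSum (fun z : S => cpr μ {ω | Y2 ω = (z : ℝ)} (E true) *
      Real.exp (-(η * (z : ℝ)))) (pr μ (E false) * (Real.exp (h y1) / pr μ (E true))) := by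
    simp_rw [fun z : S => htilt z z.2]
    refine (hasSum_pr_fiber hB hY2 hY2B (hEmeas false) fun z hz => ?_).mul_right _
    obtain ⟨ω, hω⟩ : ({ω | Y2 ω = z} ∩ E false).Nonempty := by
      by_contra hempty
      simp [pr, Set.not_nonempty_iff_eq_empty.1 hempty] at hz
    have hle : pr μ ({ω | Y2 ω = z} ∩ E false) ≤ pr μ {ω | Y1 ω = y1 ∧ Y2 ω = z} :=
      measureReal_mono fun ω hω => ⟨hω.2.1, hω.1⟩
    exact ⟨hω.1 ▸ hY2B ω, (lt_of_le_of_ne ENNReal.toReal_nonneg hz.symm).trans_le hle⟩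
  have hscale : 0 < Real.exp (h y1) / pr μ (E true) := div_pos (Real.exp_pos _) h1
  refine ⟨hsum.summable, hsum.tsum_eq.symm ▸ mul_pos h0 hscale, ?_⟩
  refine Eq.trans ?_ (congrArg _ hsum.tsum_eq.symm)
  rw [htilt y ⟨hy, hpos⟩, mul_div_mul_right _ _ hscale.ne', cpr]
end

section
/- Assume X is integrable and X·exp(−η(X + λ)) is integrable. Then E[X · 1_{Ω∖R}] = E[X · exp(−η(X + λ)) · 1_R]; that is, the contribution of the missing data to the mean is an exponentially tilted expectation over the observed data. -/
open MeasureTheory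

/-- Integrating an `m`-measurable function against the indicator of an event amounts to
integrating it against the conditional probability of that event given `m`. -/
theorem integral_mul_indicator_eq_integral_mul_condExp {Ω : Type*} {m mΩ : MeasurableSpace Ω}
    {μ : Measure Ω} [IsFiniteMeasure μ] (hm : m ≤ mΩ) {f : Ω → ℝ} (hf : StronglyMeasurable[m] f)
    (hfi : Integrable f μ) {R : Set Ω} (hR : MeasurableSet R) :
    ∫ ω, f ω * R.indicator (fun _ => (1 : ℝ)) ω ∂μ =
      ∫ ω, f ω * (μ[R.indicator (fun _ => (1 : ℝ)) | m]) ω ∂μ := by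
  have hfR : Integrable (f * R.indicator fun _ => (1 : ℝ)) μ := by
    refine (hfi.indicator hR).congr (.of_forall fun ω => ?_)
    by_cases h : ω ∈ R <;> simp [h]
  have hRi : Integrable (R.indicator fun _ => (1 : ℝ)) μ := (integrable_const 1).indicator hR
  calc ∫ ω, f ω * R.indicator (fun _ => (1 : ℝ)) ω ∂μ
      = ∫ ω, (μ[f * R.indicator (fun _ => (1 : ℝ)) | m]) ω ∂μ := (integral_condExp hm).symm
    _ = _ := integral_congr_ae (condExp_mul_of_stronglyMeasurable_left hf hfR hRi)

theorem exp_neg_mul_expit (t : ℝ) : Real.exp (-t) * expit t = 1 - expit t := by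
  have : 0 < 1 + Real.exp t := by positivity
  rw [expit, Real.exp_neg]
  field_simp
  ring

/-- Under the logistic missing-data mechanism `P(R = 1 | X) = expit(η(X + λ))`, the
contribution of the missing data to the mean is an exponentially tilted expectation over
the observed data: `E[X · 1_{Ω∖R}] = E[X · exp(−η(X + λ)) · 1_R]`. -/
theorem stmt7 {Ω : Type*} {F : MeasurableSpace Ω} (μ : Measure Ω) [IsProbabilityMeasure μ]
    (X : Ω → ℝ) (hX : Measurable X)
    (R : Set Ω) (hR : MeasurableSet R)
    (η lam : ℝ)
    (hmdm : μ[R.indicator (fun _ => (1 : ℝ)) | MeasurableSpace.comap X inferInstance]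
      =ᵐ[μ] fun ω => expit (η * (X ω + lam)))
    (hXint : Integrable X μ)
    (hXtilt : Integrable (fun ω => X ω * Real.exp (-(η * (X ω + lam)))) μ) :
    ∫ ω, X ω * Rᶜ.indicator (fun _ => (1 : ℝ)) ω ∂μ =
      ∫ ω, X ω * Real.exp (-(η * (X ω + lam))) * R.indicator (fun _ => (1 : ℝ)) ω ∂μ := by
  have hm : MeasurableSpace.comap X inferInstance ≤ F := hX.comap_le
  have hXm : Measurable[MeasurableSpace.comap X inferInstance] X := comap_measurable X
  have hg : Measurable fun x : ℝ => x * Real.exp (-(η * (x + lam))) := by fun_prop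
  have hXR : Integrable (fun ω => X ω * R.indicator (fun _ => (1 : ℝ)) ω) μ := by
    refine (hXint.indicator hR).congr (.of_forall fun ω => ?_)
    by_cases h : ω ∈ R <;> simp [h]
  have hp : Integrable
      (fun ω => X ω * (μ[R.indicator (fun _ => (1 : ℝ)) | MeasurableSpace.comap X inferInstance]) ω)
      μ :=
    integrable_condExp.congr (condExp_mul_of_stronglyMeasurable_left hXm.stronglyMeasurable hXR
      ((integrable_const 1).indicator hR))
  calc ∫ ω, X ω * Rᶜ.indicator (fun _ => (1 : ℝ)) ω ∂μ
      = ∫ ω, (X ω - X ω * R.indicator (fun _ => (1 : ℝ)) ω) ∂μ := by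
        congr 1 with ω
        by_cases h : ω ∈ R <;> simp [h]
    _ = ∫ ω, (X ω - X ω * (μ[R.indicator (fun _ => (1 : ℝ)) |
          MeasurableSpace.comap X inferInstance]) ω) ∂μ := by
        rw [integral_sub hXint hXR, integral_sub hXint hp,
          integral_mul_indicator_eq_integral_mul_condExp hm hXm.stronglyMeasurable hXint hR]
    _ = ∫ ω, X ω * Real.exp (-(η * (X ω + lam))) * (μ[R.indicator (fun _ => (1 : ℝ)) |
          MeasurableSpace.comap X inferInstance]) ω ∂μ := by
        refine integral_congr_ae ?_
        filter_upwards [hmdm] with ω h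
        rw [h, mul_assoc, exp_neg_mul_expit]
        ring
    _ = _ := (integral_mul_indicator_eq_integral_mul_condExp hm
        (hg.comp hXm).stronglyMeasurable hXtilt hR).symm
end

section
/- Define Z = c + ρ̃·(Y − μ)/√v + √(1 − ρ̃²)·W. Then for every Borel set S ⊆ ℝ, P({Y ∈ S} ∩ {Z > 0}) = ∫_S (2πv)^{−1/2} · exp(−(y − μ)²/(2v)) · Φ( (c + ρ̃(y − μ)/√v)/√(1 − ρ̃²) ) dy; consequently the conditional distribution of Y given selection {Z > 0} has Lebesgue density f(y | Z > 0) = (2πv)^{−1/2} exp(−(y − μ)²/(2v)) · Φ(v(y)) / Φ(c), where v(y) = (c + ρ̃(y − μ)/√v)/√(1 − ρ̃²). (This is the observed-data likelihood of the Copas selection model: log f(y | z > 0) = log f(y) + log P(z > 0 | y) − log P(z > 0).) -/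
open MeasureTheory ProbabilityTheory
open scoped NNReal

/-- The standard normal cumulative distribution function `Φ`. -/
noncomputable def stdNormalCDF (x : ℝ) : ℝ :=
  ((ProbabilityTheory.gaussianReal 0 1) (Set.Iic x)).toReal

/-- If `X` is standard normal and `0 < r`, then `P(0 < t + r X) = Φ(t / r)`. -/
lemma ProbabilityTheory.HasLaw.measureReal_pos_const_add_mul {Ω : Type*} [MeasurableSpace Ω]
    {P : Measure Ω} {X : Ω → ℝ} (hX : HasLaw X (gaussianReal 0 1) P) (t : ℝ) {r : ℝ}
    (hr : 0 < r) : P.real {ω | 0 < t + r * X ω} = stdNormalCDF (t / r) := by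
  have hneg : HasLaw (-X) (gaussianReal 0 1) P := by simpa using gaussianReal_neg hX
  have := nullSingletonClass_gaussianReal (μ := 0) (v := 1) one_ne_zero
  have hset : {ω | 0 < t + r * X ω} = {ω | (-X) ω < t / r} := by
    ext ω
    simp only [Set.mem_ofPred_eq, Pi.neg_apply, lt_div_iff₀ hr]
    constructor <;> intro h <;> linarith
  rw [hset, hneg.measureReal_eq (p := fun x => x < t / r) measurableSet_Iio, stdNormalCDF,
    ← measureReal_def]
  exact measureReal_congr Iio_ae_eq_Iic

lemma stdNormalCDF_eq_measureReal (t : ℝ) {r : ℝ} (hr : 0 < r) :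
    stdNormalCDF (t / r) = (gaussianReal 0 1).real {w | 0 < t + r * w} :=
  (HasLaw.id.measureReal_pos_const_add_mul t hr).symm

lemma gaussianPDFReal_eq_rpow (m : ℝ) (v : ℝ≥0) (y : ℝ) :
    gaussianPDFReal m v y = (2 * Real.pi * (v : ℝ)) ^ (-(1 / 2) : ℝ) *
      Real.exp (-(y - m) ^ 2 / (2 * (v : ℝ))) := by
  rw [gaussianPDFReal, Real.rpow_neg (by positivity), Real.sqrt_eq_rpow]

/-- Integrating out the noise `W` in a selection event `{0 < g(Y) + r W}`. -/
lemma ProbabilityTheory.IndepFun.measureReal_inter_pos_add_mul {Ω : Type*} [MeasurableSpace Ω]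
    {P : Measure Ω} [IsProbabilityMeasure P] {Y W : Ω → ℝ} {ν : Measure ℝ}
    (hindep : IndepFun Y W P) (hY : HasLaw Y ν P) (hW : HasLaw W (gaussianReal 0 1) P)
    {g : ℝ → ℝ} (hg : Measurable g) {r : ℝ} (hr : 0 < r) {S : Set ℝ} (hS : MeasurableSet S) :
    P.real ({ω | Y ω ∈ S} ∩ {ω | 0 < g (Y ω) + r * W ω}) =
      ∫ y in S, stdNormalCDF (g y / r) ∂ν := by
  have : IsProbabilityMeasure ν := hY.map_eq ▸ Measure.isProbabilityMeasure_map hY.aemeasurable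
  have hlaw : HasLaw (fun ω => (Y ω, W ω)) (ν.prod (gaussianReal 0 1)) P :=
    ⟨hY.aemeasurable.prodMk hW.aemeasurable, by
      rw [hindep.map_prod_eq_prod_map_map hY.aemeasurable hW.aemeasurable, hY.map_eq, hW.map_eq]⟩
  have hpos : MeasurableSet {p : ℝ × ℝ | 0 < g p.1 + r * p.2} :=
    measurableSet_lt measurable_const (by fun_prop)
  have hmeas : MeasurableSet {p : ℝ × ℝ | p.1 ∈ S ∧ 0 < g p.1 + r * p.2} :=
    (measurable_fst hS).inter hpos
  have hfiber : Measurable fun y => gaussianReal 0 1 {w | 0 < g y + r * w} :=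
    measurable_measure_prodMk_left hpos
  have hsection (y : ℝ) :
      gaussianReal 0 1 (Prod.mk y ⁻¹' {p : ℝ × ℝ | p.1 ∈ S ∧ 0 < g p.1 + r * p.2}) =
        S.indicator (fun y => gaussianReal 0 1 {w | 0 < g y + r * w}) y := by
    by_cases hy : y ∈ S <;> simp [hy]
  simp_rw [stdNormalCDF_eq_measureReal _ hr, measureReal_def]
  rw [integral_toReal hfiber.aemeasurable
    (ae_of_all _ fun _ => measure_lt_top _ _), ← lintegral_indicator hS]
  simp_rw [← hsection]
  rw [← Measure.prod_apply hmeas]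
  exact congrArg ENNReal.toReal (hlaw.measure_eq hmeas)

/-- A unit-variance linear combination of a standardized Gaussian and independent standard normal
noise is standard normal. -/
lemma ProbabilityTheory.IndepFun.hasLaw_standardized_add {Ω : Type*} [MeasurableSpace Ω]
    {P : Measure Ω} {Y W : Ω → ℝ} {m : ℝ} {v : ℝ≥0} (hindep : IndepFun Y W P)
    (hY : HasLaw Y (gaussianReal m v) P) (hW : HasLaw W (gaussianReal 0 1) P) (hv : 0 < v)
    {ρ : ℝ} (hρ : ρ ^ 2 ≤ 1) :
    HasLaw (fun ω => ρ * (Y ω - m) / √(v : ℝ) + √(1 - ρ ^ 2) * W ω) (gaussianReal 0 1) P := by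
  have h₁ := gaussianReal_div_const (gaussianReal_const_mul (gaussianReal_sub_const hY m) ρ)
    √(v : ℝ)
  have h₂ := gaussianReal_const_mul hW √(1 - ρ ^ 2)
  have hcomp := hindep.comp (φ := fun y => ρ * (y - m) / √(v : ℝ))
    (ψ := fun w => √(1 - ρ ^ 2) * w) (by fun_prop) (by fun_prop)
  refine ⟨h₁.aemeasurable.add h₂.aemeasurable, ?_⟩
  refine (gaussianReal_add_gaussianReal_of_indepFun hcomp h₁.map_eq h₂.map_eq).trans ?_
  congr 1
  · simp
  · have hv_ne : (v : ℝ) ≠ 0 := by exact_mod_cast hv.ne'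
    ext
    simp [Real.sq_sqrt (sub_nonneg.2 hρ), hv_ne]

/-- Observed-data likelihood of the Copas selection model: for every Borel set `S`,
`P(Y ∈ S, Z > 0) = ∫_S (2πv)^{-1/2} exp(−(y − μ)²/(2v)) Φ(v(y)) dy` with
`v(y) = (c + ρ̃(y − μ)/√v)/√(1 − ρ̃²)`; consequently the conditional distribution of `Y`
given selection `{Z > 0}` has Lebesgue density
`f(y | Z > 0) = (2πv)^{-1/2} exp(−(y − μ)²/(2v)) Φ(v(y)) / Φ(c)`. -/
theorem stmt13 {Ω : Type*} [MeasurableSpace Ω] (P : Measure Ω) [IsProbabilityMeasure P]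
    (v : ℝ≥0) (hv : 0 < v) (c : ℝ) (ρt : ℝ) (hρt : ρt ∈ Set.Ioo (-1 : ℝ) 1)
    (m : ℝ) (Y W : Ω → ℝ) (hYmeas : Measurable Y) (hWmeas : Measurable W)
    (hYlaw : P.map Y = gaussianReal m v) (hWlaw : P.map W = gaussianReal 0 1)
    (hindep : IndepFun Y W P)
    (Z : Ω → ℝ)
    (hZ : Z = fun ω =>
      c + ρt * (Y ω - m) / Real.sqrt (v : ℝ) + Real.sqrt (1 - ρt ^ 2) * W ω) :
    (∀ S : Set ℝ, MeasurableSet S →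
      (P ({ω | Y ω ∈ S} ∩ {ω | 0 < Z ω})).toReal =
        ∫ y in S, (2 * Real.pi * (v : ℝ)) ^ (-(1 / 2) : ℝ) *
          Real.exp (-(y - m) ^ 2 / (2 * (v : ℝ))) *
          stdNormalCDF ((c + ρt * (y - m) / Real.sqrt (v : ℝ)) / Real.sqrt (1 - ρt ^ 2))) ∧
    (∀ S : Set ℝ, MeasurableSet S →
      (P ({ω | Y ω ∈ S} ∩ {ω | 0 < Z ω})).toReal / (P {ω | 0 < Z ω}).toReal =
        ∫ y in S, (2 * Real.pi * (v : ℝ)) ^ (-(1 / 2) : ℝ) *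
          Real.exp (-(y - m) ^ 2 / (2 * (v : ℝ))) *
          stdNormalCDF ((c + ρt * (y - m) / Real.sqrt (v : ℝ)) / Real.sqrt (1 - ρt ^ 2)) /
          stdNormalCDF c) := by
  have hY : HasLaw Y (gaussianReal m v) P := ⟨hYmeas.aemeasurable, hYlaw⟩
  have hW : HasLaw W (gaussianReal 0 1) P := ⟨hWmeas.aemeasurable, hWlaw⟩
  have hρ : ρt ^ 2 < 1 := (sq_lt_one_iff_abs_lt_one ρt).2 (abs_lt.2 hρt)
  have hr : 0 < Real.sqrt (1 - ρt ^ 2) := Real.sqrt_pos.2 (sub_pos.2 hρ)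
  subst hZ
  have hjoint (S : Set ℝ) (hS : MeasurableSet S) :=
    hindep.measureReal_inter_pos_add_mul hY hW
      (g := fun y => c + ρt * (y - m) / Real.sqrt (v : ℝ)) (by fun_prop) hr hS
  have hselect : P.real {ω | 0 < c + ρt * (Y ω - m) / Real.sqrt (v : ℝ) +
      Real.sqrt (1 - ρt ^ 2) * W ω} = stdNormalCDF c := by
    simpa [add_assoc] using
      (hindep.hasLaw_standardized_add hY hW hv hρ.le).measureReal_pos_const_add_mul c one_pos
  have hdensity (S : Set ℝ) (hS : MeasurableSet S) (f : ℝ → ℝ) :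
      ∫ y in S, f y ∂gaussianReal m v = ∫ y in S, gaussianPDFReal m v y * f y := by
    rw [gaussianReal_of_var_ne_zero _ hv.ne', setIntegral_withDensity_eq_setIntegral_toReal_smul
      (measurable_gaussianPDF _ _) (ae_of_all _ fun _ => gaussianPDF_lt_top) _ hS]
    simp
  simp_rw [← measureReal_def, ← gaussianPDFReal_eq_rpow, integral_div, hselect]
  refine ⟨fun S hS => ?_, fun S hS => ?_⟩ <;> rw [hjoint S hS, hdensity S hS]
end
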